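/- For every k ≥ 2, the prediction and localization numbers satisfy the equality 𝔳^g_k = max{𝔳^g_{k+1}, 𝔏_k}. -/

import Mathlib

/-- A tree: a set of finite sequences of naturals closed under initial segments. -/
def IsTree (T : Set (List ℕ)) : Prop :=
  ∀ σ ∈ T, ∀ n : ℕ, σ.take n ∈ T

/-- The immediate successors of a node `σ` within `T`. -/
def succs (T : Set (List ℕ)) (σ : List ℕ) : Set ℕ :=
  {m : ℕ | σ ++ [m] ∈ T}

/-- A `k`-tree: a tree in which every node has at least `1` and at most `k`
immediate successors. -/
def IsKTree (k : ℕ) (T : Set (List ℕ)) : Prop :=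
  IsTree T ∧ ∀ σ ∈ T, 1 ≤ (succs T σ).encard ∧ (succs T σ).encard ≤ k

/-- The initial segment `f↾n = ⟨f 0, …, f (n-1)⟩`. -/
def seg (f : ℕ → ℕ) (n : ℕ) : List ℕ :=
  List.ofFn fun i : Fin n => f i

/-- `f` is a branch of `T` if all its finite initial segments belong to `T`. -/
def IsBranch (T : Set (List ℕ)) (f : ℕ → ℕ) : Prop :=
  ∀ n : ℕ, seg f n ∈ T

/-- A `k` globally adaptive predictor: a sequence `⟨π_n : n ∈ ℕ⟩` of functions,
where `π_n` assigns to each sequence `s ∈ ℕ^n` a `k`-element set of naturals. -/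
structure Predictor (k : ℕ) where
  π : (n : ℕ) → (Fin n → ℕ) → Finset ℕ
  card_π : ∀ n s, (π n s).card = k

/-- `f` is predicted by `p` if from some point on, `f n ∈ π_n (f↾n)`. -/
def Predicts {k : ℕ} (p : Predictor k) (f : ℕ → ℕ) : Prop :=
  ∃ m : ℕ, ∀ n : ℕ, m < n → f n ∈ p.π n fun i : Fin n => f i

/-- A `k`-branching tree: a tree in which every node has either exactly `1` or
exactly `k` immediate successors. -/
def IsKBranching (k : ℕ) (T : Set (List ℕ)) : Prop :=
  IsTree T ∧ ∀ σ ∈ T, (succs T σ).encard = 1 ∨ (succs T σ).encard = k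

/-- The prediction number `𝔳^g_k`: the smallest cardinality of a set of `k`
globally adaptive predictors predicting every `f : ℕ → ℕ`. -/
noncomputable def predNum (k : ℕ) : Cardinal :=
  sInf {c : Cardinal | ∃ P : Set (Predictor k), Cardinal.mk P = c ∧
    ∀ f : ℕ → ℕ, ∃ p ∈ P, Predicts p f}

/-- The `k`-localization number `𝔏_k`: the smallest cardinality of a family of
`k`-branching trees such that every `f : ℕ → {0,…,k}` is a branch of one of them. -/
noncomputable def locNum (k : ℕ) : Cardinal :=
  sInf {c : Cardinal | ∃ 𝒯 : Set (Set (List ℕ)), Cardinal.mk 𝒯 = c ∧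
    (∀ T ∈ 𝒯, IsKBranching k T) ∧
    ∀ f : ℕ → ℕ, (∀ n, f n ≤ k) → ∃ T ∈ 𝒯, IsBranch T f}

open Cardinal in
/-- A finite set of predictors fails to predict some function. -/
theorem aleph0_le_mk_of_forall_predicts {k : ℕ} (P : Set (Predictor k))
    (hP : ∀ f : ℕ → ℕ, ∃ p ∈ P, Predicts p f) : ℵ₀ ≤ #P := by
  classical
  by_contra! hlt
  have hfin : P.Finite := Cardinal.lt_aleph0_iff_set_finite.mp hlt
  let U : (n : ℕ) → (Fin n → ℕ) → Finset ℕ := fun n s => hfin.toFinset.biUnion fun p => p.π n s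
  choose e he using fun n s => Infinite.exists_notMem_finset (U n s)
  let f : ℕ → ℕ := fun n =>
    Nat.strongRec (motive := fun _ => ℕ) (fun n ih => e n fun i : Fin n => ih i i.2) n
  have hf : ∀ n, f n = e n fun i : Fin n => f i := fun n => by
    simp only [f]
    rw [Nat.strongRec_eq]
  obtain ⟨p, hp, m, hm⟩ := hP f
  have h := hm (m + 1) (Nat.lt_succ_self m)
  rw [hf (m + 1)] at h
  exact he _ _ (Finset.mem_biUnion.mpr ⟨p, hfin.mem_toFinset.mpr hp, h⟩)

theorem exists_finset_card_eq_of_subset (k : ℕ) (A : Finset ℕ) :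
    ∃ B : Finset ℕ, B.card = k ∧ (A.card ≤ k → A ⊆ B) := by
  by_cases h : A.card ≤ k
  · obtain ⟨B, hAB, hB⟩ := Infinite.exists_superset_card_eq A k h
    exact ⟨B, hB, fun _ => hAB⟩
  · exact ⟨Finset.range k, Finset.card_range k, fun hle => absurd hle h⟩

/-- The predictor whose value at `s` contains `A n s` whenever the latter has at most `k`
elements. -/
noncomputable def Predictor.ofCandidates (k : ℕ) (A : (n : ℕ) → (Fin n → ℕ) → Finset ℕ) :
    Predictor k where
  π n s := (exists_finset_card_eq_of_subset k (A n s)).choose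
  card_π n s := (exists_finset_card_eq_of_subset k (A n s)).choose_spec.1

theorem Predictor.subset_ofCandidates {k : ℕ} {A : (n : ℕ) → (Fin n → ℕ) → Finset ℕ} {n : ℕ}
    {s : Fin n → ℕ} (h : (A n s).card ≤ k) : A n s ⊆ (Predictor.ofCandidates k A).π n s :=
  (exists_finset_card_eq_of_subset k (A n s)).choose_spec.2 h

theorem exists_mk_eq_predNum {k : ℕ} (hk : 1 ≤ k) :
    ∃ P : Set (Predictor k), Cardinal.mk P = predNum k ∧
      ∀ f : ℕ → ℕ, ∃ p ∈ P, Predicts p f := by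
  refine csInf_mem (s := {c : Cardinal | ∃ P : Set (Predictor k), Cardinal.mk P = c ∧
    ∀ f : ℕ → ℕ, ∃ p ∈ P, Predicts p f}) ⟨_, Set.univ, rfl, fun f => ?_⟩
  refine ⟨Predictor.ofCandidates k fun n _ => {f n}, trivial, 0, fun n _ => ?_⟩
  exact Predictor.subset_ofCandidates (by simpa using hk) (Finset.mem_singleton_self _)

theorem predNum_le_of_forall_predicts {k : ℕ} (P : Set (Predictor k))
    (hP : ∀ f : ℕ → ℕ, ∃ p ∈ P, Predicts p f) : predNum k ≤ Cardinal.mk P :=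
  csInf_le' ⟨P, rfl, hP⟩

theorem aleph0_le_predNum {k : ℕ} (hk : 1 ≤ k) : Cardinal.aleph0 ≤ predNum k := by
  obtain ⟨P, hc, hP⟩ := exists_mk_eq_predNum hk
  exact hc ▸ aleph0_le_mk_of_forall_predicts P hP

theorem predNum_succ_le {k : ℕ} (hk : 1 ≤ k) : predNum (k + 1) ≤ predNum k := by
  obtain ⟨P, hc, hP⟩ := exists_mk_eq_predNum hk
  rw [← hc]
  refine (predNum_le_of_forall_predicts
    ((fun p : Predictor k => Predictor.ofCandidates (k + 1) p.π) '' P) fun f => ?_).trans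
    Cardinal.mk_image_le
  obtain ⟨p, hp, m, hm⟩ := hP f
  exact ⟨_, ⟨p, hp, rfl⟩, m, fun n hn =>
    Predictor.subset_ofCandidates (by rw [p.card_π]; exact Nat.le_succ k) (hm n hn)⟩

/-- The tree of sequences each of whose entries is allowed by `A` given the preceding ones. -/
def treeOf (A : List ℕ → Set ℕ) : Set (List ℕ) :=
  {σ | ∀ (i : ℕ) (h : i < σ.length), σ[i] ∈ A (σ.take i)}

theorem isTree_treeOf (A : List ℕ → Set ℕ) : IsTree (treeOf A) := by
  intro σ hσ n i h
  rw [List.length_take] at h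
  rw [List.getElem_take, List.take_take, min_eq_left (by omega)]
  exact hσ i (by omega)

theorem succs_treeOf {A : List ℕ → Set ℕ} {σ : List ℕ} (hσ : σ ∈ treeOf A) :
    succs (treeOf A) σ = A σ := by
  ext x
  constructor
  · intro h
    simpa using h σ.length (by simp)
  · intro h i hi
    rw [List.length_append, List.length_singleton] at hi
    rcases Nat.lt_succ_iff_lt_or_eq.mp hi with hi | rfl
    · rw [List.getElem_append_left hi, List.take_append_of_le_length hi.le]
      exact hσ i hi
    · simpa using h

theorem take_seg (f : ℕ → ℕ) {i n : ℕ} (h : i ≤ n) : (seg f n).take i = seg f i := by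
  apply List.ext_getElem <;> simp [seg, h]

theorem isBranch_treeOf {A : List ℕ → Set ℕ} {f : ℕ → ℕ} (h : ∀ n, f n ∈ A (seg f n)) :
    IsBranch (treeOf A) f := by
  intro n i hi
  have hin : i < n := by simpa [seg] using hi
  rw [take_seg f hin.le]
  simpa [seg] using h i

/-- The values allowed after `σ` when first following `s` and then the predictor `p`. -/
def Predictor.allowed {k : ℕ} (p : Predictor k) (s σ : List ℕ) : Set ℕ :=
  if σ.length < s.length then {s.getD σ.length 0}
  else p.π σ.length fun i => σ.getD i 0

theorem isKBranching_treeOf_allowed {k : ℕ} (p : Predictor k) (s : List ℕ) :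
    IsKBranching k (treeOf (p.allowed s)) := by
  refine ⟨isTree_treeOf _, fun σ hσ => ?_⟩
  rw [succs_treeOf hσ, Predictor.allowed]
  split_ifs
  · exact Or.inl (Set.encard_singleton _)
  · right
    rw [Set.encard_coe_eq_coe_finsetCard, p.card_π]

theorem Predictor.mem_allowed_seg {k : ℕ} {p : Predictor k} {f : ℕ → ℕ} {m : ℕ}
    (hm : ∀ n : ℕ, m < n → f n ∈ p.π n fun i : Fin n => f i) (n : ℕ) :
    f n ∈ p.allowed (seg f (m + 1)) (seg f n) := by
  have hlen : ∀ n, (seg f n).length = n := fun n => by simp [seg]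
  have hget : ∀ {i n}, i < n → (seg f n).getD i 0 = f i := fun {i n} h => by
    rw [List.getD_eq_getElem _ _ (by rwa [hlen])]
    simp [seg]
  rw [Predictor.allowed]
  split_ifs with h
  · rw [hlen, hlen] at h
    rw [hlen, hget h]
    rfl
  · rw [hlen, hlen] at h
    have key : ∀ l, l = n → f n ∈ p.π l fun i => (seg f n).getD i 0 := by
      rintro l rfl
      convert hm l (by omega) using 2
      funext i
      exact hget i.2
    exact key _ (hlen n)

theorem exists_branching_family {k : ℕ} (hk : 1 ≤ k) :
    ∃ 𝒯 : Set (Set (List ℕ)), Cardinal.mk 𝒯 ≤ predNum k ∧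
      (∀ T ∈ 𝒯, IsKBranching k T) ∧
      ∀ f : ℕ → ℕ, (∀ n, f n ≤ k) → ∃ T ∈ 𝒯, IsBranch T f := by
  obtain ⟨P, hc, hP⟩ := exists_mk_eq_predNum hk
  refine ⟨Set.range fun x : P × List ℕ => treeOf (x.1.1.allowed x.2), ?_, ?_, fun f _ => ?_⟩
  · refine Cardinal.mk_range_le.trans ?_
    rw [Cardinal.mk_prod, Cardinal.lift_id, Cardinal.lift_id, Cardinal.mk_eq_aleph0 (List ℕ), hc,
      Cardinal.mul_aleph0_eq (aleph0_le_predNum hk)]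
  · rintro _ ⟨x, rfl⟩
    exact isKBranching_treeOf_allowed _ _
  · obtain ⟨p, hp, m, hm⟩ := hP f
    exact ⟨_, ⟨(⟨p, hp⟩, seg f (m + 1)), rfl⟩, isBranch_treeOf (Predictor.mem_allowed_seg hm)⟩

theorem locNum_le_predNum {k : ℕ} (hk : 1 ≤ k) : locNum k ≤ predNum k := by
  obtain ⟨𝒯, hc, h⟩ := exists_branching_family hk
  exact (csInf_le' ⟨𝒯, rfl, h⟩ : locNum k ≤ Cardinal.mk 𝒯).trans hc

theorem exists_mk_eq_locNum {k : ℕ} (hk : 1 ≤ k) :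
    ∃ 𝒯 : Set (Set (List ℕ)), Cardinal.mk 𝒯 = locNum k ∧
      (∀ T ∈ 𝒯, IsKBranching k T) ∧
      ∀ f : ℕ → ℕ, (∀ n, f n ≤ k) → ∃ T ∈ 𝒯, IsBranch T f := by
  obtain ⟨𝒯, -, h⟩ := exists_branching_family hk
  exact csInf_mem (s := {c : Cardinal | ∃ 𝒯 : Set (Set (List ℕ)), Cardinal.mk 𝒯 = c ∧
    (∀ T ∈ 𝒯, IsKBranching k T) ∧
    ∀ f : ℕ → ℕ, (∀ n, f n ≤ k) → ∃ T ∈ 𝒯, IsBranch T f}) ⟨_, 𝒯, rfl, h⟩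

/-- The position of `x` in the increasing enumeration of `A`, truncated at `k`. -/
def rankIn (k : ℕ) (A : Finset ℕ) (x : ℕ) : ℕ :=
  min k (A.filter (· < x)).card

theorem rankIn_injOn {k : ℕ} {A : Finset ℕ} (hA : A.card = k + 1) :
    Set.InjOn (rankIn k A) A := by
  have hlt : ∀ x ∈ A, (A.filter (· < x)).card < k + 1 := fun x hx =>
    hA ▸ Finset.card_lt_card (Finset.filter_ssubset.mpr ⟨x, hx, lt_irrefl x⟩)
  have hmono : StrictMonoOn (rankIn k A) A := by
    intro x hx y hy hxy
    have hcard : (A.filter (· < x)).card < (A.filter (· < y)).card := by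
      refine Finset.card_lt_card ((Finset.ssubset_iff_of_subset fun z hz => ?_).mpr ⟨x, ?_, ?_⟩)
      · rw [Finset.mem_filter] at hz ⊢
        exact ⟨hz.1, hz.2.trans hxy⟩
      · exact Finset.mem_filter.mpr ⟨hx, hxy⟩
      · simp
    have hx' := hlt x hx
    have hy' := hlt y hy
    simp only [rankIn]
    omega
  exact hmono.injOn

/-- The sequence of positions of the entries of `s` within the predictions of `p`. -/
def Predictor.code {k : ℕ} (p : Predictor (k + 1)) (n : ℕ) (s : Fin n → ℕ) : List ℕ :=
  List.ofFn fun i : Fin n => rankIn k (p.π i fun j : Fin i => s ⟨j, j.2.trans i.2⟩) (s i)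

open Classical in
/-- Those predictions of `p` whose positions are permitted by the tree `T`. -/
noncomputable def Predictor.restrict {k : ℕ} (p : Predictor (k + 1)) (T : Set (List ℕ)) :
    Predictor k :=
  Predictor.ofCandidates k fun n s =>
    (p.π n s).filter fun x => rankIn k (p.π n s) x ∈ succs T (p.code n s)

theorem Predictor.predicts_restrict {k : ℕ} (hk : 1 ≤ k) {p : Predictor (k + 1)}
    {T : Set (List ℕ)} (hT : IsKBranching k T) {f : ℕ → ℕ} (hf : Predicts p f)
    (hb : IsBranch T fun n => rankIn k (p.π n fun i : Fin n => f i) (f n)) :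
    Predicts (p.restrict T) f := by
  classical
  obtain ⟨m, hm⟩ := hf
  refine ⟨m, fun n hn => ?_⟩
  set s : Fin n → ℕ := fun i => f i
  have hcode : p.code n s ∈ T := hb n
  have hsucc : (succs T (p.code n s)).encard ≤ k := by
    rcases hT.2 _ hcode with h | h
    · rw [h]
      exact_mod_cast hk
    · exact h.le
  have hmem : rankIn k (p.π n s) (f n) ∈ succs T (p.code n s) := by
    have h := hb (n + 1)
    rw [seg, List.ofFn_succ_last] at h
    exact h
  refine Predictor.subset_ofCandidates ?_ (Finset.mem_filter.mpr ⟨hm n hn, hmem⟩)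
  rw [← Nat.cast_le (α := ℕ∞), ← Set.encard_coe_eq_coe_finsetCard]
  refine le_trans ?_ hsucc
  refine Set.encard_le_encard_of_injOn (f := rankIn k (p.π n s)) (fun x hx => ?_) ?_
  · exact (Finset.mem_filter.mp hx).2
  · exact (rankIn_injOn (p.card_π n s)).mono fun x hx => (Finset.mem_filter.mp hx).1

theorem predNum_le_max {k : ℕ} (hk : 1 ≤ k) :
    predNum k ≤ max (predNum (k + 1)) (locNum k) := by
  obtain ⟨P, hcP, hP⟩ := exists_mk_eq_predNum (Nat.le_add_left 1 k)
  obtain ⟨𝒯, hcT, hbr, hcov⟩ := exists_mk_eq_locNum hk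
  rw [← hcP, ← hcT]
  refine (predNum_le_of_forall_predicts
    (Set.range fun x : P × 𝒯 => x.1.1.restrict x.2.1) fun f => ?_).trans
    (Cardinal.mk_range_le.trans ?_)
  · obtain ⟨p, hp, hpf⟩ := hP f
    obtain ⟨T, hT, hb⟩ := hcov (fun n => rankIn k (p.π n fun i : Fin n => f i) (f n))
      fun n => min_le_left _ _
    exact ⟨_, ⟨(⟨p, hp⟩, ⟨T, hT⟩), rfl⟩, Predictor.predicts_restrict hk (hbr T hT) hpf hb⟩
  · rw [Cardinal.mk_prod, Cardinal.lift_id, Cardinal.lift_id]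
    exact Cardinal.mul_le_max_of_aleph0_le_left (aleph0_le_mk_of_forall_predicts P hP)

theorem stmt14 (k : ℕ) (hk : 2 ≤ k) :
    predNum k = max (predNum (k + 1)) (locNum k) := by
  have hk' : 1 ≤ k := one_le_two.trans hk
  exact le_antisymm (predNum_le_max hk') (max_le (predNum_succ_le hk') (locNum_le_predNum hk'))
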